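/- arXiv:1009.0575 — 3 statements merged into one kernel-verified Lean document; each statement's English description precedes it below -/
import Mathlib

section
/- The closed unit disk Metric.closedBall (0 : EuclideanSpace ℝ (Fin 2)) 1, with the subspace topology, admits no circle decomposition. -/
open Topology Set

/-- A circle in a topological space `X`: a subset homeomorphic to the unit circle. -/
def IsCircle {X : Type*} [TopologicalSpace X] (C : Set X) : Prop :=
  Nonempty (C ≃ₜ Circle)

/-- A circle decomposition of `X`: a set of pairwise disjoint circles whose union is `X`. -/
def IsCircleDecomposition {X : Type*} [TopologicalSpace X] (𝒞 : Set (Set X)) : Prop :=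
  (∀ C ∈ 𝒞, IsCircle C) ∧
  (∀ C ∈ 𝒞, ∀ D ∈ 𝒞, C ≠ D → Disjoint C D) ∧
  ⋃₀ 𝒞 = Set.univ

open unitInterval in
/-- The function `z ↦ (z - γ 0) / (z - γ 1)` has a continuous logarithm off the path `γ`. -/
theorem exists_continuousOn_exp_eq_div (γ : C(I, ℂ)) :
    ∃ g : ℂ → ℂ, ContinuousOn g (range γ)ᶜ ∧
      ∀ z ∈ (range γ)ᶜ, Complex.exp (g z) = (z - γ 0) / (z - γ 1) := by
  classical
  have hne (t : I) (z : ((range γ)ᶜ : Set ℂ)) : (z : ℂ) - γ t ≠ 0 :=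
    fun h ↦ z.2 ⟨t, (sub_eq_zero.1 h).symm⟩
  let H : C(I × ((range γ)ᶜ : Set ℂ), {z : ℂ // z ≠ 0}) :=
    { toFun := fun x ↦ ⟨(x.2 - γ 0) / (x.2 - γ x.1), div_ne_zero (hne _ _) (hne _ _)⟩
      continuous_toFun := by
        refine Continuous.subtype_mk (Continuous.div ?_ ?_ fun x ↦ hne _ _) _ <;> fun_prop }
  have H_zero (z) : H (0, z) = ⟨Complex.exp 0, Complex.exp_ne_zero _⟩ :=
    Subtype.ext (by simp [H, div_self (hne 0 z)])
  let G := Complex.isCoveringMap_exp.liftHomotopy H (ContinuousMap.const _ 0) H_zero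
  refine ⟨fun z ↦ if hz : z ∈ (range γ)ᶜ then G (1, ⟨z, hz⟩) else 0, ?_, fun z hz ↦ ?_⟩
  · rw [continuousOn_iff_continuous_domRestrict]
    convert! (G.continuous.comp (Continuous.prodMk_right (1 : I))) using 1
    ext z
    simp only [Set.domRestrict_apply, dif_pos z.2, Function.comp_apply]
  · have := congr_arg Subtype.val
      (congr_fun (Complex.isCoveringMap_exp.liftHomotopy_lifts H (ContinuousMap.const _ 0) H_zero)
        (1, ⟨z, hz⟩))
    simp only [dif_pos hz]
    exact this

/-- Two continuous logarithms of the same function on a preconnected set differ by a constant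
integer multiple of `2πi`. -/
theorem IsPreconnected.exists_int_eq_add_of_exp_eq {X : Type*} [TopologicalSpace X] {S : Set X}
    (hS : IsPreconnected S) {f g : X → ℂ} (hf : ContinuousOn f S) (hg : ContinuousOn g S)
    (h : ∀ x ∈ S, Complex.exp (f x) = Complex.exp (g x)) :
    ∃ k : ℤ, ∀ x ∈ S, f x = g x + k * (2 * Real.pi * Complex.I) := by
  rcases S.eq_empty_or_nonempty with rfl | ⟨x₀, hx₀⟩
  · exact ⟨0, by simp⟩
  obtain ⟨k, hk⟩ := Complex.exp_eq_exp_iff_exists_int.1 (h x₀ hx₀)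
  refine ⟨k, fun x hx ↦ ?_⟩
  have hd : DiscreteTopology (range (Int.cast : ℤ → ℂ)) :=
    (Complex.isClosedEmbedding_intCast.isEmbedding.toHomeomorph).discreteTopology
  have hmaps : MapsTo (fun x ↦ (f x - g x) / (2 * Real.pi * Complex.I)) S
      (range (Int.cast : ℤ → ℂ)) := by
    intro x hx
    obtain ⟨n, hn⟩ := Complex.exp_eq_exp_iff_exists_int.1 (h x hx)
    refine ⟨n, ?_⟩
    simp only [hn, add_sub_cancel_left]
    rw [mul_div_cancel_right₀ _ Complex.two_pi_I_ne_zero]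
  have := hS.constant_of_mapsTo (isDiscrete_iff_discreteTopology.2 hd)
    ((hf.sub hg).div_const _) hmaps hx hx₀
  simp only [Pi.sub_apply] at this
  rw [div_left_inj' Complex.two_pi_I_ne_zero, hk, add_sub_cancel_left] at this
  rw [← this]; ring

/-- The function `z ↦ (z - p) / (z - q)` has no continuous logarithm on `ℂ ∖ {p, q}`. -/
theorem not_exists_continuousOn_exp_eq_div {p q : ℂ} (hpq : p ≠ q) :
    ¬ ∃ G : ℂ → ℂ, ContinuousOn G {p, q}ᶜ ∧
      ∀ z ∈ ({p, q}ᶜ : Set ℂ), Complex.exp (G z) = (z - p) / (z - q) := by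
  rintro ⟨G, hG, hexp⟩
  have hpq' : p - q ≠ 0 := sub_ne_zero.2 hpq
  have hc (θ : ℝ) : p + (p - q) / 2 * Complex.exp (θ * Complex.I) ∈ ({p, q}ᶜ : Set ℂ) ∧
      (p + (p - q) / 2 * Complex.exp (θ * Complex.I) - q) / (p - q) ∈ Complex.slitPlane := by
    have hre : -1 ≤ (Complex.exp (θ * Complex.I)).re := by
      rw [Complex.exp_ofReal_mul_I_re]; exact Real.neg_one_le_cos θ
    have heq : (p + (p - q) / 2 * Complex.exp (θ * Complex.I) - q) / (p - q) =
        1 + Complex.exp (θ * Complex.I) / 2 := by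
      field_simp; ring
    have hmem : (p + (p - q) / 2 * Complex.exp (θ * Complex.I) - q) / (p - q) ∈
        Complex.slitPlane := by
      rw [heq]
      left
      simp only [Complex.add_re, Complex.one_re, Complex.div_ofNat_re]
      linarith
    refine ⟨?_, hmem⟩
    rintro (h | h)
    · simp [hpq', Complex.exp_ne_zero] at h
    · rw [mem_singleton_iff] at h
      rw [h, sub_self, zero_div] at hmem
      exact Complex.zero_notMem_slitPlane hmem
  let c : ℝ → ℂ := fun θ ↦ p + (p - q) / 2 * Complex.exp (θ * Complex.I)
  have hcont : Continuous c := by fun_prop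
  let L : ℝ → ℂ := fun θ ↦ G (c θ) + Complex.log ((c θ - q) / (p - q))
  have hLcont : Continuous L :=
    (hG.comp_continuous hcont fun θ ↦ (hc θ).1).add
      (((hcont.sub continuous_const).div_const _).clog fun θ ↦ (hc θ).2)
  have hLexp (θ : ℝ) : Complex.exp (L θ) = Complex.exp (L 0 + θ * Complex.I) := by
    have key (θ : ℝ) : Complex.exp (L θ) = Complex.exp (θ * Complex.I) / 2 := by
      have hq : c θ - q ≠ 0 := fun h ↦ (hc θ).1 (Or.inr (sub_eq_zero.1 h))
      rw [show L θ = G (c θ) + Complex.log ((c θ - q) / (p - q)) from rfl, Complex.exp_add,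
        hexp _ (hc θ).1, Complex.exp_log (div_ne_zero hq hpq'),
        div_mul_div_cancel₀ hq]
      rw [show c θ - p = p + (p - q) / 2 * Complex.exp (θ * Complex.I) - p from rfl,
        add_sub_cancel_left]
      field_simp
    rw [Complex.exp_add (L 0), key, key]
    simp
    ring
  obtain ⟨k, hk⟩ := isPreconnected_univ.exists_int_eq_add_of_exp_eq hLcont.continuousOn
    (g := fun θ : ℝ ↦ L 0 + θ * Complex.I) (by fun_prop) fun θ _ ↦ hLexp θ
  have h0 := hk 0 trivial
  have h1 := hk (2 * Real.pi) trivial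
  have hper : L (2 * Real.pi) = L 0 := by simp [L, c]
  have := Complex.two_pi_I_ne_zero
  rw [hper] at h1
  push_cast at h0 h1
  apply this
  linear_combination h0 - h1

open unitInterval in
/-- Two paths in the plane with the same distinct endpoints that do not meet elsewhere separate
the plane. -/
theorem not_isPreconnected_compl_range_union_range {α β : C(I, ℂ)} (h0 : α 0 = β 0)
    (h1 : α 1 = β 1) (hne : α 0 ≠ α 1) (hαβ : range α ∩ range β ⊆ {α 0, α 1}) :
    ¬ IsPreconnected (range α ∪ range β)ᶜ := by
  classical
  intro hS
  obtain ⟨a, ha, haexp⟩ := exists_continuousOn_exp_eq_div α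
  obtain ⟨b, hb, hbexp⟩ := exists_continuousOn_exp_eq_div β
  have hαo : IsOpen (range α)ᶜ := (isCompact_range α.continuous).isClosed.isOpen_compl
  have hβo : IsOpen (range β)ᶜ := (isCompact_range β.continuous).isClosed.isOpen_compl
  rw [compl_union] at hS
  obtain ⟨k, hk⟩ := hS.exists_int_eq_add_of_exp_eq (ha.mono inter_subset_left)
    (hb.mono inter_subset_right) fun z hz ↦ by rw [haexp z hz.1, hbexp z hz.2, h0, h1]
  refine not_exists_continuousOn_exp_eq_div hne
    ⟨(range α)ᶜ.piecewise a fun z ↦ b z + k * (2 * Real.pi * Complex.I), ?_, ?_⟩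
  · intro z hz
    refine ContinuousAt.continuousWithinAt ?_
    by_cases hzα : z ∈ (range α)ᶜ
    · refine (ha.continuousAt (hαo.mem_nhds hzα)).congr ?_
      filter_upwards [hαo.mem_nhds hzα] with w hw
      exact (piecewise_eq_of_mem _ _ _ hw).symm
    · have hzβ : z ∈ (range β)ᶜ := fun h ↦ hz (hαβ ⟨not_not.1 hzα, h⟩)
      refine ((hb.continuousAt (hβo.mem_nhds hzβ)).add_const
        (k * (2 * Real.pi * Complex.I))).congr ?_
      filter_upwards [hβo.mem_nhds hzβ] with w hw
      by_cases hwα : w ∈ (range α)ᶜ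
      · rw [piecewise_eq_of_mem _ _ _ hwα, hk w ⟨hwα, hw⟩]
      · rw [piecewise_eq_of_notMem _ _ _ hwα]
  · intro z hz
    by_cases hzα : z ∈ (range α)ᶜ
    · rw [piecewise_eq_of_mem _ _ _ hzα, haexp z hzα]
    · have hzβ : z ∈ (range β)ᶜ := fun h ↦ hz (hαβ ⟨not_not.1 hzα, h⟩)
      rw [piecewise_eq_of_notMem _ _ _ hzα, Complex.exp_periodic.int_mul k, hbexp z hzβ, h0, h1]

open unitInterval in
/-- A circle separates the plane. -/
theorem IsCircle.not_isPreconnected_compl {C : Set ℂ} (hC : IsCircle C) :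
    ¬ IsPreconnected Cᶜ := by
  obtain ⟨e⟩ := hC
  let f : Circle → ℂ := fun z ↦ e.symm z
  have hf : Continuous f := by fun_prop
  have hinj : Function.Injective f := Subtype.val_injective.comp e.symm.injective
  have hrange : range f = C := by
    rw [show f = Subtype.val ∘ e.symm from rfl, range_comp, e.symm.surjective.range_eq, image_univ,
      Subtype.range_coe]
  let α : C(I, ℂ) := ⟨fun t ↦ f (Circle.exp (Real.pi * t)), by fun_prop⟩
  let β : C(I, ℂ) := ⟨fun t ↦ f (Circle.exp (-(Real.pi * t))), by fun_prop⟩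
  have hpi := Real.pi_pos
  have hunion : range α ∪ range β = C := by
    rw [← hrange]
    refine Subset.antisymm (union_subset ?_ ?_) ?_
    · rintro _ ⟨t, rfl⟩; exact mem_range_self _
    · rintro _ ⟨t, rfl⟩; exact mem_range_self _
    · rintro _ ⟨z, rfl⟩
      have hz := Circle.exp_arg z
      have h1 := Complex.neg_pi_lt_arg (z : ℂ)
      have h2 := Complex.arg_le_pi (z : ℂ)
      rcases le_total 0 (Complex.arg z) with h | h
      · refine Or.inl ⟨⟨Complex.arg z / Real.pi, by positivity, (div_le_one hpi).2 h2⟩, ?_⟩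
        simp [α, mul_div_cancel₀ _ hpi.ne', hz]
      · refine Or.inr ⟨⟨-Complex.arg z / Real.pi, div_nonneg (by linarith) hpi.le,
          (div_le_one hpi).2 (by linarith)⟩, ?_⟩
        have : -(Real.pi * (-Complex.arg z / Real.pi)) = Complex.arg z := by field_simp
        simp only [β, ContinuousMap.coe_mk, this, hz]
  rw [← hunion]
  refine not_isPreconnected_compl_range_union_range ?_ ?_ ?_ ?_
  · simp [α, β]
  · have : Circle.exp (-Real.pi) = Circle.exp Real.pi :=
      Circle.exp_eq_exp.2 ⟨-1, by push_cast; ring⟩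
    simp only [α, β, ContinuousMap.coe_mk, Icc.coe_one, mul_one, this]
  · intro h
    have := congr_arg Subtype.val (hinj h)
    norm_num at this
  · rintro _ ⟨⟨t, rfl⟩, s, hs⟩
    obtain ⟨m, hm⟩ := Circle.exp_eq_exp.1 (hinj hs)
    have ht0 := t.2.1
    have ht1 := t.2.2
    have hs0 := s.2.1
    have hs1 := s.2.2
    have hm' : (t : ℝ) + s = -m * 2 := by
      apply mul_left_cancel₀ hpi.ne'
      linear_combination -hm
    have : (-m : ℤ) = 0 ∨ 1 ≤ (-m : ℤ) := by
      have : (-1 : ℝ) < (-m : ℤ) := by push_cast; linarith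
      have : (-1 : ℤ) < -m := by exact_mod_cast this
      omega
    rcases this with h | h
    · left
      have h' : (-m : ℝ) = 0 := by exact_mod_cast h
      rw [show t = 0 from Subtype.ext (by simp only [Icc.coe_zero]; nlinarith)]
    · right
      have h' : (1 : ℝ) ≤ -m := by exact_mod_cast h
      rw [mem_singleton_iff, show t = 1 from Subtype.ext (by simp only [Icc.coe_one]; nlinarith)]

theorem IsCircle.isCompact {X : Type*} [TopologicalSpace X] {C : Set X} (hC : IsCircle C) :
    IsCompact C :=
  isCompact_iff_compactSpace.2 hC.some.symm.compactSpace

theorem IsCircle.isConnected {X : Type*} [TopologicalSpace X] {C : Set X} (hC : IsCircle C) :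
    IsConnected C := by
  have : ConnectedSpace Circle :=
    Circle.exp_surjective.connectedSpace Circle.exp.continuous
  exact isConnected_iff_connectedSpace.2 (hC.some.symm.surjective.connectedSpace
    hC.some.symm.continuous)

theorem IsCircle.image {X Y : Type*} [TopologicalSpace X] [TopologicalSpace Y] {C : Set X}
    (hC : IsCircle C) {f : X → Y} (hf : IsEmbedding f) : IsCircle (f '' C) :=
  ⟨(hf.homeomorphImage C).symm.trans hC.some⟩

theorem Complex.isPreconnected_compl_closedBall_zero (r : ℝ) :
    IsPreconnected (Metric.closedBall (0 : ℂ) r)ᶜ := by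
  have h : (Metric.closedBall (0 : ℂ) r)ᶜ =
      (fun x : ℝ × ℝ ↦ x.1 * Complex.exp (x.2 * Complex.I)) '' (Ioi r ×ˢ univ) := by
    ext z
    simp only [mem_compl_iff, mem_closedBall_zero_iff, not_le]
    constructor
    · exact fun hz ↦ ⟨(‖z‖, Complex.arg z), ⟨hz, trivial⟩, Complex.norm_mul_exp_arg_mul_I z⟩
    · rintro ⟨⟨s, θ⟩, ⟨hs, -⟩, rfl⟩
      simpa [Complex.norm_exp_ofReal_mul_I] using lt_of_lt_of_le hs (le_abs_self s)
  rw [h]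
  exact (isPreconnected_Ioi.prod isPreconnected_univ).image _ (by fun_prop)

theorem closure_connectedComponentIn_subset {X : Type*} [TopologicalSpace X]
    [LocallyConnectedSpace X] {F : Set X} (hF : IsOpen F) (x : X) :
    closure (connectedComponentIn F x) ⊆ connectedComponentIn F x ∪ Fᶜ := by
  intro y hy
  by_cases hyF : y ∈ F
  · obtain ⟨w, hwy, hwx⟩ := mem_closure_iff.1 hy _ hF.connectedComponentIn
      (mem_connectedComponentIn hyF)
    left
    rw [connectedComponentIn_eq hwx, ← connectedComponentIn_eq hwy]
    exact mem_connectedComponentIn hyF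
  · exact Or.inr hyF

/-- A closed disk in the complex plane is not a union of pairwise disjoint circles. -/
theorem not_exists_circles_sUnion_eq_closedBall {r : ℝ} (hr : 0 ≤ r) :
    ¬ ∃ 𝒟 : Set (Set ℂ), (∀ C ∈ 𝒟, IsCircle C) ∧
      (∀ C ∈ 𝒟, ∀ D ∈ 𝒟, C ≠ D → Disjoint C D) ∧ ⋃₀ 𝒟 = Metric.closedBall (0 : ℂ) r := by
  rintro ⟨𝒟, hcirc, hdisj, hunion⟩
  obtain ⟨z₀, hz₀⟩ : ∃ z₀ : ℂ, z₀ ∈ (Metric.closedBall (0 : ℂ) r)ᶜ :=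
    ⟨((r + 1 : ℝ) : ℂ), by
      rw [mem_compl_iff, mem_closedBall_zero_iff, Complex.norm_real, Real.norm_eq_abs, not_le]
      exact (lt_add_one r).trans_le (le_abs_self _)⟩
  have hsub {C} (hC : C ∈ 𝒟) : C ⊆ Metric.closedBall (0 : ℂ) r :=
    hunion ▸ subset_sUnion_of_mem hC
  have hopen {C} (hC : C ∈ 𝒟) : IsOpen Cᶜ := (hcirc C hC).isCompact.isClosed.isOpen_compl
  let U : Set ℂ → Set ℂ := fun C ↦ connectedComponentIn Cᶜ z₀
  have hz₀U {C} (hC : C ∈ 𝒟) : z₀ ∈ U C :=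
    mem_connectedComponentIn fun h ↦ hz₀ (hsub hC h)
  have hUC (C) : U C ⊆ Cᶜ := connectedComponentIn_subset _ _
  have hmono {C D p} (hC : C ∈ 𝒟) (hD : D ∈ 𝒟) (hp : p ∈ D) (hpC : p ∉ U C) : U C ⊆ U D := by
    rcases eq_or_ne C D with rfl | hne
    · exact subset_rfl
    · refine isPreconnected_connectedComponentIn.subset_connectedComponentIn (hz₀U hC) ?_
      intro z hz hzD
      refine hpC ?_
      have hDC : D ⊆ Cᶜ := (hdisj C hC D hD hne).subset_compl_left
      rw [show U C = _ from connectedComponentIn_eq hz]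
      exact (hcirc D hD).isConnected.isPreconnected.subset_connectedComponentIn hzD hDC hp
  obtain ⟨_, ⟨⟨C, hC, rfl⟩, hmax⟩⟩ := zorn_subset (U '' 𝒟) fun c hc hchain ↦ by
    obtain ⟨p, hp, hpc⟩ : ∃ p ∈ Metric.closedBall (0 : ℂ) r, p ∉ ⋃₀ c := by
      by_contra! hcon
      rcases c.eq_empty_or_nonempty with rfl | hne
      · simpa using hcon 0 (by simpa using hr)
      have : Nonempty c := hne.to_subtype
      obtain ⟨⟨V, hV⟩, hcov⟩ := (isCompact_closedBall (0 : ℂ) r).elim_directed_cover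
        (fun V : c ↦ (V : Set ℂ))
        (fun V ↦ by
          obtain ⟨C, hC, hCV⟩ := hc V.2
          rw [← hCV]
          exact (hopen hC).connectedComponentIn)
        (by rwa [← sUnion_eq_iUnion]) hchain.directedOn.directed_val
      obtain ⟨C, hC, rfl⟩ := hc hV
      obtain ⟨x, hx⟩ := (hcirc C hC).isConnected.nonempty
      exact hUC C (hcov (hsub hC hx)) hx
    obtain ⟨D, hD, hpD⟩ := hunion.symm ▸ hp
    refine ⟨U D, mem_image_of_mem U hD, fun V hV ↦ ?_⟩
    obtain ⟨C, hC, rfl⟩ := hc hV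
    exact hmono hC hD hpD fun h ↦ hpc ⟨_, hV, h⟩
  obtain ⟨p, hpC, hpU⟩ : ∃ p ∈ Cᶜ, p ∉ U C := by
    by_contra! h
    refine (hcirc C hC).not_isPreconnected_compl ?_
    rw [show Cᶜ = U C from Subset.antisymm h (hUC C)]
    exact isPreconnected_connectedComponentIn
  have hp : p ∈ Metric.closedBall (0 : ℂ) r := by
    by_contra hp
    exact hpU ((Complex.isPreconnected_compl_closedBall_zero r).subset_connectedComponentIn hz₀
      (compl_subset_compl.2 (hsub hC)) hp)
  obtain ⟨D, hD, hpD⟩ := hunion.symm ▸ hp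
  have hCD : U C = U D :=
    Subset.antisymm (hmono hC hD hpD hpU)
      (hmax (mem_image_of_mem U hD) (hmono hC hD hpD hpU))
  have hdisjCD : Disjoint C D := hdisj C hC D hD fun h ↦ hpC (h ▸ hpD)
  have hclosed : IsClosed (U C) := by
    refine isClosed_of_closure_subset fun z hz ↦ ?_
    rcases closure_connectedComponentIn_subset (hopen hC) z₀ hz with h | h
    · exact h
    rw [hCD] at hz ⊢
    rcases closure_connectedComponentIn_subset (hopen hD) z₀ hz with h' | h'
    · exact h'
    · exact (disjoint_left.1 hdisjCD (not_not.1 h) (not_not.1 h')).elim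
  have huniv : U C = univ :=
    IsClopen.eq_univ ⟨hclosed, (hopen hC).connectedComponentIn⟩ ⟨z₀, hz₀U hC⟩
  exact hpU (huniv ▸ mem_univ p)

/-- The closed unit disk admits no circle decomposition. -/
theorem closedDisk_no_circle_decomposition :
    ¬ ∃ 𝒞 : Set (Set (Metric.closedBall (0 : EuclideanSpace ℝ (Fin 2)) 1)),
      IsCircleDecomposition 𝒞 := by
  rintro ⟨𝒞, hcirc, hdisj, hunion⟩
  let e : ℂ ≃ₗᵢ[ℝ] EuclideanSpace ℝ (Fin 2) := Complex.orthonormalBasisOneI.repr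
  let φ : Metric.closedBall (0 : EuclideanSpace ℝ (Fin 2)) 1 → ℂ := fun x ↦ e.symm x
  have hφ : IsEmbedding φ := e.symm.toHomeomorph.isEmbedding.comp .subtypeVal
  refine not_exists_circles_sUnion_eq_closedBall zero_le_one ⟨(φ '' ·) '' 𝒞, ?_, ?_, ?_⟩
  · rintro _ ⟨C, hC, rfl⟩
    exact (hcirc C hC).image hφ
  · rintro _ ⟨C, hC, rfl⟩ _ ⟨D, hD, rfl⟩ hne
    exact (disjoint_image_iff hφ.injective).2 (hdisj C hC D hD fun h ↦ hne (h ▸ rfl))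
  · rw [← image_sUnion, hunion, image_univ]
    ext z
    rw [mem_closedBall_zero_iff]
    constructor
    · rintro ⟨x, rfl⟩
      have hx := mem_closedBall_zero_iff.1 x.2
      simpa only [φ, LinearIsometryEquiv.norm_map] using hx
    · exact fun hz ↦ ⟨⟨e z, by simpa using hz⟩, by simp [φ]⟩
end

section
/- If 𝒞 is a circle decomposition of a surface S, then no element of 𝒞 bounds a disk in S. -/
open Topology Set

/-- A circle `C` bounds a disk in `X` if there is a topological embedding of the closed
unit disk into `X` carrying the boundary circle onto `C`. -/
def BoundsADisk {X : Type*} [TopologicalSpace X] (C : Set X) : Prop :=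
  ∃ f : (Metric.closedBall (0 : EuclideanSpace ℝ (Fin 2)) 1) → X,
    Topology.IsEmbedding f ∧
    f '' {x | (x : EuclideanSpace ℝ (Fin 2)) ∈
      Metric.sphere (0 : EuclideanSpace ℝ (Fin 2)) 1} = C

/-- A complex-valued function has a continuous logarithm. -/
def HasContLog {A : Type*} [TopologicalSpace A] (f : A → ℂ) : Prop :=
  ∃ g : A → ℂ, Continuous g ∧ ∀ a, Complex.exp (g a) = f a

namespace HasContLog

variable {A : Type*} [TopologicalSpace A]

theorem const {c : ℂ} (hc : c ≠ 0) : HasContLog (fun _ : A ↦ c) :=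
  ⟨fun _ ↦ Complex.log c, continuous_const, fun _ ↦ Complex.exp_log hc⟩

theorem mul {f g : A → ℂ} (hf : HasContLog f) (hg : HasContLog g) :
    HasContLog (fun a ↦ f a * g a) := by
  obtain ⟨F, hF, hF'⟩ := hf
  obtain ⟨G, hG, hG'⟩ := hg
  exact ⟨fun a ↦ F a + G a, hF.add hG, fun a ↦ by rw [Complex.exp_add, hF', hG']⟩

/-- Having a continuous logarithm is invariant under homotopies through nonvanishing functions. -/
theorem of_homotopy {H : unitInterval × A → ℂ} (hc : Continuous H) (hH : ∀ x, H x ≠ 0)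
    (h₀ : HasContLog (fun a ↦ H (0, a))) : HasContLog (fun a ↦ H (1, a)) := by
  obtain ⟨g, hg, hgH⟩ := h₀
  let H' : C(unitInterval × A, {z : ℂ // z ≠ 0}) := ⟨fun x ↦ ⟨H x, hH x⟩, by fun_prop⟩
  have hlift : ∀ a, H' (0, a) = ⟨Complex.exp (g a), Complex.exp_ne_zero _⟩ := fun a ↦
    Subtype.ext (hgH a).symm
  let L := Complex.isCoveringMap_exp.liftHomotopy H' ⟨g, hg⟩ hlift
  refine ⟨fun a ↦ L (1, a), by fun_prop, fun a ↦ ?_⟩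
  have := congrFun (Complex.isCoveringMap_exp.liftHomotopy_lifts H' ⟨g, hg⟩ hlift) (1, a)
  exact congrArg Subtype.val this

end HasContLog

/-- A continuous function with constant exponential on a preconnected set is constant. -/
theorem IsPreconnected.constOn_of_exp {A : Type*} [TopologicalSpace A] {s : Set A}
    (hs : IsPreconnected s) {g : A → ℂ} (hg : ContinuousOn g s) {c : ℂ}
    (h : ∀ a ∈ s, Complex.exp (g a) = c) {a b : A} (ha : a ∈ s) (hb : b ∈ s) : g a = g b := by
  have cov := Complex.isCoveringMap_exp
  refine cov.isSeparatedMap.constOn_of_comp cov.isLocalHomeomorph.isLocallyInjective hs hg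
    (fun x hx y hy ↦ Subtype.ext ?_) ha hb
  exact (h x hx).trans (h y hy).symm

/-- An odd function on the circle has no continuous logarithm. -/
theorem not_hasContLog_of_odd {f : Circle → ℂ} (hf : ∀ z, f (-z) = -f z) : ¬ HasContLog f := by
  rintro ⟨g, hg, hgf⟩
  have key : ∀ z : Circle, Complex.exp (g (-z) - g z) = -1 := fun z ↦ by
    have : f z ≠ 0 := hgf z ▸ Complex.exp_ne_zero _
    rw [Complex.exp_sub, hgf, hgf, hf, neg_div, div_self this]
  have h := isPreconnected_univ.constOn_of_exp (g := fun z : Circle ↦ g (-z) - g z)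
    (by fun_prop) (fun z _ ↦ key z) (mem_univ (-1)) (mem_univ 1)
  have h0 : g (-1) - g 1 = 0 := by
    simp only [neg_neg] at h
    linear_combination (-1 / 2 : ℂ) * h
  have := key 1
  rw [h0, Complex.exp_zero] at this
  norm_num at this

theorem not_hasContLog_circle : ¬ HasContLog (fun z : Circle ↦ (z : ℂ)) :=
  not_hasContLog_of_odd fun z ↦ by simp

/-- Invariance of domain in the plane, for closed disks. -/
theorem image_closedBall_mem_nhds {g : ℂ → ℂ} {c : ℂ} {r : ℝ} (hr : 0 < r)
    (hg : ContinuousOn g (Metric.closedBall c r)) (hinj : InjOn g (Metric.closedBall c r)) :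
    g '' Metric.closedBall c r ∈ 𝓝 (g c) := by
  have hmem : ∀ (t : ℝ) (u : Circle), |t| ≤ 1 → c + r * (t * u) ∈ Metric.closedBall c r := by
    intro t u ht
    have : |r| * (|t| * 1) ≤ r := by
      rw [abs_of_pos hr]; nlinarith
    simpa [dist_eq_norm, Circle.norm_coe] using this
  have hcont : ∀ {B : Type} [TopologicalSpace B] {t : B → ℝ} {u : B → Circle}, Continuous t →
      Continuous u → (∀ b, |t b| ≤ 1) → Continuous fun b ↦ g (c + r * (t b * u b)) := by
    intro B _ t u ht hu h1
    exact hg.comp_continuous (by fun_prop) fun b ↦ hmem _ _ (h1 b)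
  have hnolog : ¬ HasContLog (fun u : Circle ↦ g (c + r * u) - g c) := by
    intro h
    let H : unitInterval × Circle → ℂ := fun x ↦
      g (c + r * (((1 / (1 + x.1) : ℝ) : ℂ) * x.2)) -
        g (c + r * (((-x.1 / (1 + x.1) : ℝ) : ℂ) * x.2))
    have hpos : ∀ t : unitInterval, 0 < 1 + (t : ℝ) := fun t ↦ by linarith [t.2.1]
    have b1 : ∀ t : unitInterval, |1 / (1 + (t : ℝ))| ≤ 1 := fun t ↦ by
      rw [abs_of_pos (by have := hpos t; positivity), div_le_one (hpos t)]; linarith [t.2.1]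
    have b2 : ∀ t : unitInterval, |-(t : ℝ) / (1 + (t : ℝ))| ≤ 1 := fun t ↦ by
      rw [abs_div, abs_neg, abs_of_nonneg t.2.1, abs_of_pos (hpos t), div_le_one (hpos t)]
      linarith
    have hHc : Continuous H := by
      refine (hcont ?_ continuous_snd fun x ↦ b1 x.1).sub (hcont ?_ continuous_snd fun x ↦ b2 x.1)
      · exact continuous_const.div (by fun_prop) fun x ↦ (hpos x.1).ne'
      · exact Continuous.div (by fun_prop) (by fun_prop) fun x ↦ (hpos x.1).ne'
    have hH0 : ∀ x, H x ≠ 0 := by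
      rintro ⟨t, u⟩ h0
      have h1 := hinj (hmem _ u (b1 t)) (hmem _ u (b2 t)) (sub_eq_zero.1 h0)
      have hr' : (r : ℂ) ≠ 0 := by exact_mod_cast hr.ne'
      have h2 := mul_right_cancel₀ u.coe_ne_zero (mul_left_cancel₀ hr' (add_left_cancel h1))
      have h3 : 1 / (1 + (t : ℝ)) = -t / (1 + (t : ℝ)) := by exact_mod_cast h2
      have h4 := (div_left_inj' (hpos t).ne').1 h3
      linarith [t.2.1]
    have h1 : HasContLog (fun u ↦ H (1, u)) := by
      refine HasContLog.of_homotopy hHc hH0 ?_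
      simpa [H] using h
    refine not_hasContLog_of_odd (fun u ↦ ?_) h1
    simp only [H, Circle.coe_neg, Set.Icc.coe_one]
    rw [neg_sub]
    congr 3 <;> push_cast <;> ring
  let K := range fun u : Circle ↦ g (c + r * u)
  have hK : Continuous fun u : Circle ↦ g (c + r * u) := by
    simpa using hcont (t := fun _ : Circle ↦ 1) continuous_const continuous_id (by simp)
  have hKc : IsClosed K := (isCompact_range hK).isClosed
  have hcK : g c ∈ Kᶜ := by
    rintro ⟨u, hu⟩
    have := hinj (by simpa using hmem 1 u (by simp)) (by simp [hr.le]) hu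
    simp [hr.ne'] at this
  obtain ⟨δ, hδ, hball⟩ := Metric.isOpen_iff.1 hKc.isOpen_compl _ hcK
  refine Filter.mem_of_superset (Metric.ball_mem_nhds _ hδ) fun q hq ↦ ?_
  by_contra hq'
  have hl : HasContLog (fun u : Circle ↦ g (c + r * u) - q) := by
    have := HasContLog.of_homotopy
      (H := fun x : unitInterval × Circle ↦ g (c + r * (((x.1 : ℝ) : ℂ) * x.2)) - q)
      ((hcont (by fun_prop) continuous_snd fun x ↦ by
        rw [abs_of_nonneg x.1.2.1]; exact x.1.2.2).sub continuous_const)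
      (fun x h0 ↦ hq' ⟨_, hmem _ _ (by rw [abs_of_nonneg x.1.2.1]; exact x.1.2.2),
        sub_eq_zero.1 h0⟩) ?_
    · simpa using this
    · have : g c - q ≠ 0 := fun h0 ↦ hq' ⟨c, by simp [hr.le], sub_eq_zero.1 h0⟩
      simpa using HasContLog.const this
  apply hnolog
  have := HasContLog.of_homotopy
    (H := fun x : unitInterval × Circle ↦ g (c + r * x.2) - (q + ((x.1 : ℝ) : ℂ) * (g c - q)))
    (by
      have : Continuous fun x : unitInterval × Circle ↦ g (c + r * x.2) := hK.comp continuous_snd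
      exact this.sub (by fun_prop))
    (fun x h0 ↦ ?_) (by simpa using hl)
  · simpa using this
  · have hx : q + ((x.1 : ℝ) : ℂ) * (g c - q) ∈ Metric.ball (g c) δ := by
      have := (convex_ball (g c) δ).add_smul_sub_mem hq (Metric.mem_ball_self hδ) x.1.2
      simpa using this
    exact hball hx ⟨x.2, sub_eq_zero.1 h0⟩

/-- The quotient `(z - a) / (z - b)` has a continuous logarithm away from a path from `a` to `b`. -/
theorem exists_log_compl_range {γ : unitInterval → ℂ} (hγ : Continuous γ) :
    ∃ g : ℂ → ℂ, ContinuousOn g (range γ)ᶜ ∧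
      ∀ z ∈ (range γ)ᶜ, Complex.exp (g z) = (z - γ 0) / (z - γ 1) := by
  have hne : ∀ (t : unitInterval) (z : ↥(range γ)ᶜ), (z : ℂ) - γ t ≠ 0 := fun t z h0 ↦
    z.2 ⟨t, (sub_eq_zero.1 h0).symm⟩
  obtain ⟨g, hg, hg'⟩ := HasContLog.of_homotopy
    (H := fun x : unitInterval × ↥(range γ)ᶜ ↦ ((x.2 : ℂ) - γ 0) / (x.2 - γ x.1))
    (Continuous.div (by fun_prop) (by fun_prop) fun x ↦ hne _ _)
    (fun x ↦ div_ne_zero (hne _ _) (hne _ _))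
    (by simpa [div_self (hne 0 _)] using HasContLog.const one_ne_zero)
  classical
  refine ⟨fun z ↦ if h : z ∈ (range γ)ᶜ then g ⟨z, h⟩ else 0, ?_, fun z hz ↦ ?_⟩
  · rw [continuousOn_iff_continuous_domRestrict]
    refine hg.congr fun z ↦ ?_
    rw [Set.domRestrict_apply, dif_pos z.2]
  · dsimp only
    rw [dif_pos hz, hg' ⟨z, hz⟩]

/-- The quotient `(z - a) / (z - b)` has no continuous logarithm away from `a` and `b`. -/
theorem not_exists_log_compl_pair {a b : ℂ} (hab : a ≠ b) :
    ¬ ∃ g : ℂ → ℂ, ContinuousOn g {a, b}ᶜ ∧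
      ∀ z ∈ ({a, b} : Set ℂ)ᶜ, Complex.exp (g z) = (z - a) / (z - b) := by
  rintro ⟨g, hg, hg'⟩
  have hab' : a - b ≠ 0 := sub_ne_zero.2 hab
  let r : ℝ := ‖a - b‖ / 2
  have hr : 0 < r := by have := norm_pos_iff.2 hab'; positivity
  have hr' : (r : ℂ) ≠ 0 := by exact_mod_cast hr.ne'
  have hne : ∀ (t : ℝ) (u : Circle), |t| ≤ 1 → a - b + t * (r * u) ≠ 0 := by
    intro t u ht h0
    have h1 : a - b = -(t * (r * u)) := by linear_combination h0
    have h2 : ‖a - b‖ = |t| * r := by rw [h1]; simp [abs_of_pos hr, Circle.norm_coe]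
    have h3 : ‖a - b‖ = 2 * r := by simp only [r]; ring
    nlinarith
  have hmem : ∀ u : Circle, a + r * u ∈ ({a, b} : Set ℂ)ᶜ := by
    intro u h
    rcases h with h | h
    · simp [hr.ne'] at h
    · apply hne 1 u (by simp)
      have h : a + r * u = b := h
      push_cast
      linear_combination h
  have hlog : HasContLog fun u : Circle ↦ (r : ℂ) * u / (a - b + r * u) := by
    refine ⟨fun u ↦ g (a + r * u), hg.comp_continuous (by fun_prop) hmem, fun u ↦ ?_⟩
    rw [hg' _ (hmem u)]
    congr 1 <;> ring
  have habs : ∀ t : unitInterval, |1 - (t : ℝ)| ≤ 1 := fun t ↦ by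
    rw [abs_le]; constructor <;> linarith [t.2.1, t.2.2]
  have h1 := HasContLog.of_homotopy
    (H := fun x : unitInterval × Circle ↦
      (r : ℂ) * x.2 / (a - b + ((1 - x.1 : ℝ) : ℂ) * (r * x.2)))
    (Continuous.div (by fun_prop) (by fun_prop) fun x ↦ hne _ _ (habs _))
    (fun x ↦ div_ne_zero (mul_ne_zero hr' (Circle.coe_ne_zero _)) (hne _ _ (habs _)))
    (by simpa using hlog)
  have h2 := h1.mul (HasContLog.const (div_ne_zero hab' hr'))
  refine not_hasContLog_circle ?_
  convert! h2 using 2 with u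
  simp
  field_simp

/-- Two paths with the same distinct endpoints and otherwise disjoint separate the plane. -/
theorem not_isPreconnected_compl_union {γ₁ γ₂ : unitInterval → ℂ} (h₁ : Continuous γ₁)
    (h₂ : Continuous γ₂) (h0 : γ₁ 0 = γ₂ 0) (h1 : γ₁ 1 = γ₂ 1) (hne : γ₁ 0 ≠ γ₁ 1)
    (hint : range γ₁ ∩ range γ₂ ⊆ {γ₁ 0, γ₁ 1}) :
    ¬ IsPreconnected (range γ₁ ∪ range γ₂)ᶜ := by
  intro hconn
  obtain ⟨g₁, hg₁, he₁⟩ := exists_log_compl_range h₁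
  obtain ⟨g₂, hg₂, he₂⟩ := exists_log_compl_range h₂
  rw [← h0, ← h1] at he₂
  have ho₁ : IsOpen (range γ₁)ᶜ := (isCompact_range h₁).isClosed.isOpen_compl
  have ho₂ : IsOpen (range γ₂)ᶜ := (isCompact_range h₂).isClosed.isOpen_compl
  rw [compl_union] at hconn
  have hexp : ∀ z ∈ (range γ₁)ᶜ ∩ (range γ₂)ᶜ, Complex.exp (g₁ z - g₂ z) = 1 := fun z hz ↦ by
    rw [Complex.exp_sub, he₁ z hz.1, he₂ z hz.2, ← he₂ z hz.2, div_self (Complex.exp_ne_zero _)]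
  obtain ⟨k, hk, hgk⟩ : ∃ k, Complex.exp k = 1 ∧
      ∀ z ∈ (range γ₁)ᶜ ∩ (range γ₂)ᶜ, g₁ z = g₂ z + k := by
    rcases ((range γ₁)ᶜ ∩ (range γ₂)ᶜ).eq_empty_or_nonempty with h | ⟨w, hw⟩
    · exact ⟨0, by simp, by simp [h]⟩
    · refine ⟨g₁ w - g₂ w, hexp w hw, fun z hz ↦ ?_⟩
      have := hconn.constOn_of_exp (g := fun z ↦ g₁ z - g₂ z)
        ((hg₁.mono inter_subset_left).sub (hg₂.mono inter_subset_right)) hexp hz hw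
      linear_combination this
  classical
  let L : ℂ → ℂ := fun z ↦ if z ∈ range γ₁ then g₂ z + k else g₁ z
  have hL₁ : EqOn L g₁ (range γ₁)ᶜ := fun z hz ↦ if_neg hz
  have hL₂ : EqOn L (fun z ↦ g₂ z + k) (range γ₂)ᶜ := fun z hz ↦ by
    by_cases h : z ∈ range γ₁
    · exact if_pos h
    · exact (hL₁ h).trans (hgk z ⟨h, hz⟩)
  have hcover : ∀ z ∈ ({γ₁ 0, γ₁ 1} : Set ℂ)ᶜ, z ∈ (range γ₁)ᶜ ∨ z ∈ (range γ₂)ᶜ := by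
    intro z hz
    by_contra! h
    exact hz (hint ⟨not_not.1 h.1, not_not.1 h.2⟩)
  refine not_exists_log_compl_pair hne ⟨L, fun z hz ↦ ?_, fun z hz ↦ ?_⟩
  · rcases hcover z hz with h | h
    · exact (((hg₁.congr hL₁) z h).continuousAt (ho₁.mem_nhds h)).continuousWithinAt
    · exact ((((hg₂.add continuousOn_const).congr hL₂) z h).continuousAt
        (ho₂.mem_nhds h)).continuousWithinAt
  · rcases hcover z hz with h | h
    · rw [hL₁ h, he₁ z h]
    · rw [hL₂ h, Complex.exp_add, hk, mul_one, he₂ z h]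

namespace IsCircle

theorem exists_parametrization {X : Type*} [TopologicalSpace X] {C : Set X} (hC : IsCircle C) :
    ∃ h : Circle → X, Continuous h ∧ Function.Injective h ∧ range h = C := by
  obtain ⟨e⟩ := hC
  refine ⟨fun u ↦ e.symm u, by fun_prop, Subtype.val_injective.comp e.symm.injective, ?_⟩
  have := e.symm.surjective.range_comp ((↑) : C → X)
  rw [Subtype.range_coe] at this
  exact this

theorem isPreconnected {X : Type*} [TopologicalSpace X] {C : Set X} (hC : IsCircle C) :
    IsPreconnected C := by
  obtain ⟨h, hc, -, rfl⟩ := hC.exists_parametrization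
  exact isPreconnected_range hc

theorem nonempty {X : Type*} [TopologicalSpace X] {C : Set X} (hC : IsCircle C) :
    C.Nonempty := by
  obtain ⟨h, -, -, rfl⟩ := hC.exists_parametrization
  exact range_nonempty h

theorem isCompact_s3 {X : Type*} [TopologicalSpace X] {C : Set X} (hC : IsCircle C) :
    IsCompact C := by
  obtain ⟨h, hc, -, rfl⟩ := hC.exists_parametrization
  exact isCompact_range hc

/-- A Jordan curve separates the plane. -/
theorem not_isPreconnected_compl_s3 {C : Set ℂ} (hC : IsCircle C) : ¬ IsPreconnected Cᶜ := by
  obtain ⟨h, hc, hinj, rfl⟩ := hC.exists_parametrization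
  have hpi : Circle.exp Real.pi = -1 := Circle.ext (by simp)
  let γ₁ : unitInterval → ℂ := fun t ↦ h (Circle.exp (Real.pi * t))
  let γ₂ : unitInterval → ℂ := fun t ↦ h (Circle.exp (-(Real.pi * t)))
  have hc₁ : Continuous γ₁ := by fun_prop
  have hc₂ : Continuous γ₂ := by fun_prop
  have hzero : γ₁ 0 = h 1 := by simp [γ₁]
  have hone : γ₁ 1 = h (-1) := by simp [γ₁, hpi]
  have hsin : ∀ t : unitInterval, 0 ≤ Real.sin (Real.pi * t) := fun t ↦
    Real.sin_nonneg_of_nonneg_of_le_pi (mul_nonneg Real.pi_pos.le t.2.1)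
      (mul_le_of_le_one_right Real.pi_pos.le t.2.2)
  have him : ∀ x : ℝ, (Circle.exp x : ℂ).im = Real.sin x := fun x ↦ by
    rw [Circle.coe_exp, Complex.exp_ofReal_mul_I_im]
  have hunion : range γ₁ ∪ range γ₂ = range h := by
    apply Subset.antisymm
    · rintro _ (⟨t, rfl⟩ | ⟨t, rfl⟩) <;> exact mem_range_self _
    · rintro _ ⟨u, rfl⟩
      have hpos := Real.pi_pos
      have h1 := Complex.arg_le_pi (u : ℂ)
      have h2 := Complex.neg_pi_lt_arg (u : ℂ)
      rcases le_total 0 (Complex.arg u) with h0 | h0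
      · refine .inl ⟨⟨Complex.arg u / Real.pi, div_nonneg h0 hpos.le, (div_le_one hpos).2 h1⟩, ?_⟩
        simp only [γ₁]
        rw [mul_div_cancel₀ _ hpos.ne', Circle.exp_arg]
      · refine .inr ⟨⟨-Complex.arg u / Real.pi, div_nonneg (by linarith) hpos.le,
          (div_le_one hpos).2 (by linarith)⟩, ?_⟩
        simp only [γ₂]
        rw [mul_div_cancel₀ _ hpos.ne', neg_neg, Circle.exp_arg]
  rw [← hunion]
  refine not_isPreconnected_compl_union hc₁ hc₂ (by simp [γ₁, γ₂]) ?_ ?_ ?_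
  · simp [γ₁, γ₂, hpi]
  · rw [hzero, hone]
    exact fun h0 ↦ Circle.neg_ne_self 1 (hinj h0).symm
  · rintro _ ⟨⟨t, rfl⟩, ⟨s, hs⟩⟩
    have hst := hinj hs
    have h0 : Real.sin (Real.pi * t) = 0 := by
      have h1 := congrArg (fun u : Circle ↦ (u : ℂ).im) hst
      simp only [him, Real.sin_neg] at h1
      linarith [hsin t, hsin s]
    have hcos := Real.sin_eq_zero_iff_cos_eq.1 h0
    rw [hzero, hone]
    have hexp : ∀ c : ℝ, Real.cos (Real.pi * t) = c →
        (Circle.exp (Real.pi * t) : ℂ) = c := fun c hc ↦ by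
      apply Complex.ext
      · rw [Circle.coe_exp, Complex.exp_ofReal_mul_I_re, hc, Complex.ofReal_re]
      · rw [him, h0, Complex.ofReal_im]
    rcases hcos with hcos | hcos
    · exact .inl (congrArg h (Circle.ext (by simpa using hexp _ hcos)))
    · exact .inr (congrArg h (Circle.ext (by simpa using hexp _ hcos)))

end IsCircle

theorem isConnected_compl_closedBall_zero_one :
    IsConnected (Metric.closedBall (0 : ℂ) 1)ᶜ := by
  have : (Metric.closedBall (0 : ℂ) 1)ᶜ = Complex.exp '' {w | 0 < w.re} := by
    ext z
    constructor
    · intro hz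
      have h1 : 1 < ‖z‖ := by simpa using hz
      refine ⟨Complex.log z, ?_, Complex.exp_log (norm_pos_iff.1 (one_pos.trans h1))⟩
      simpa [Complex.log_re] using Real.log_pos h1
    · rintro ⟨w, hw, rfl⟩
      have hw : 0 < w.re := hw
      simpa [Complex.norm_exp] using hw
  rw [this]
  exact ((convex_halfSpace_re_gt 0).isConnected ⟨1, by simp⟩).image _
    Complex.continuous_exp.continuousOn

/-- The closed unit disk in the plane has no circle decomposition. -/
theorem closedBall_ne_sUnion_of_isCircle {𝒦 : Set (Set ℂ)} (hcirc : ∀ K ∈ 𝒦, IsCircle K)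
    (hdisj : ∀ K ∈ 𝒦, ∀ L ∈ 𝒦, K ≠ L → Disjoint K L) :
    ⋃₀ 𝒦 ≠ Metric.closedBall (0 : ℂ) 1 := by
  intro hcover
  let U : Set ℂ → Set ℂ := fun K ↦ connectedComponentIn Kᶜ 2
  have hsub : ∀ K ∈ 𝒦, K ⊆ Metric.closedBall (0 : ℂ) 1 := fun K hK ↦
    hcover ▸ subset_sUnion_of_mem hK
  have h2 : (2 : ℂ) ∈ (Metric.closedBall (0 : ℂ) 1)ᶜ := by simp
  have h2K : ∀ K ∈ 𝒦, (2 : ℂ) ∈ Kᶜ := fun K hK ↦ compl_subset_compl.2 (hsub K hK) h2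
  have hopen : ∀ K ∈ 𝒦, IsOpen (U K) := fun K hK ↦
    (hcirc K hK).isCompact_s3.isClosed.isOpen_compl.connectedComponentIn
  have hUK : ∀ K, U K ⊆ Kᶜ := fun K ↦ connectedComponentIn_subset _ _
  have hfill : ∀ K ∈ 𝒦, (U K)ᶜ ⊆ Metric.closedBall (0 : ℂ) 1 := fun K hK ↦
    compl_subset_comm.1 <| isConnected_compl_closedBall_zero_one.isPreconnected
      |>.subset_connectedComponentIn h2 (compl_subset_compl.2 (hsub K hK))
  have hcompact : ∀ K ∈ 𝒦, IsCompact (U K)ᶜ := fun K hK ↦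
    (isCompact_closedBall 0 1).of_isClosed_subset (hopen K hK).isClosed_compl (hfill K hK)
  have hnest : ∀ K ∈ 𝒦, ∀ L ∈ 𝒦, ∀ p ∈ L, p ∈ (U K)ᶜ → L ⊆ (U K)ᶜ ∧ (U L)ᶜ ⊆ (U K)ᶜ := by
    intro K hK L hL p hpL hpK
    have hLK : L ⊆ (U K)ᶜ := by
      by_cases hKL : K = L
      · exact hKL ▸ subset_compl_comm.1 (hUK K)
      · intro y hy hyU
        have h := (hcirc L hL).isPreconnected.subset_connectedComponentIn hy
          (hdisj K hK L hL hKL).subset_compl_left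
        rw [← connectedComponentIn_eq hyU] at h
        exact hpK (h hpL)
    exact ⟨hLK, compl_subset_compl.2 <| isPreconnected_connectedComponentIn
      |>.subset_connectedComponentIn (mem_connectedComponentIn (h2K K hK))
        (subset_compl_comm.1 hLK)⟩
  have hmem : ∀ p ∈ Metric.closedBall (0 : ℂ) 1, ∃ K ∈ 𝒦, p ∈ K := fun p hp ↦
    mem_sUnion.1 (hcover ▸ hp)
  obtain ⟨K₀, hK₀, -⟩ := hmem 0 (by simp)
  obtain ⟨_, -, ⟨K, hK, rfl⟩, hmin⟩ := zorn_superset_nonempty ((fun K ↦ (U K)ᶜ) '' 𝒦)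
    (fun c hc hchain hne ↦ by
      have hc' : ∀ s ∈ c, s.Nonempty ∧ IsCompact s ∧ IsClosed s := by
        intro s hs
        obtain ⟨K, hK, rfl⟩ := hc hs
        exact ⟨(hcirc K hK).nonempty.mono (subset_compl_comm.1 (hUK K)), hcompact K hK,
          (hopen K hK).isClosed_compl⟩
      obtain ⟨p, hp⟩ := IsCompact.nonempty_sInter_of_directed_nonempty_isCompact_isClosed
        (S := c) (hS := hne.to_subtype) (fun s hs t ht ↦ (hchain.total hs ht).elim
          (fun h ↦ ⟨s, hs, subset_rfl, h⟩) fun h ↦ ⟨t, ht, h, subset_rfl⟩) (fun s hs ↦ (hc' s hs).1)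
        (fun s hs ↦ (hc' s hs).2.1) (fun s hs ↦ (hc' s hs).2.2)
      have hpball : p ∈ Metric.closedBall (0 : ℂ) 1 := by
        obtain ⟨s, hs⟩ := hne
        obtain ⟨K, hK, rfl⟩ := hc hs
        exact hfill K hK (hp _ hs)
      obtain ⟨L, hL, hpL⟩ := hmem p hpball
      refine ⟨_, ⟨L, hL, rfl⟩, fun s hs ↦ ?_⟩
      obtain ⟨K, hK, rfl⟩ := hc hs
      exact (hnest K hK L hL p hpL (hp _ hs)).2) _ ⟨K₀, hK₀, rfl⟩
  obtain ⟨p, hpK, hpU⟩ : ∃ p ∈ Kᶜ, p ∉ U K := by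
    by_contra! h
    refine (hcirc K hK).not_isPreconnected_compl_s3 ?_
    rw [← (hUK K).antisymm h]
    exact isPreconnected_connectedComponentIn
  obtain ⟨L, hL, hpL⟩ := hmem p (hfill K hK hpU)
  have hKL : K ≠ L := fun h ↦ hpK (h ▸ hpL)
  have hUL : U L = U K := compl_injective <|
    (hnest K hK L hL p hpL hpU).2.antisymm (hmin ⟨L, hL, rfl⟩ (hnest K hK L hL p hpL hpU).2)
  have hclosure : ∀ M ∈ 𝒦, closure (U M) ∩ Mᶜ ⊆ U M := fun M hM ↦
    IsPreconnected.subset_connectedComponentIn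
      (isPreconnected_connectedComponentIn.subset_closure
        (subset_inter subset_closure (hUK M)) inter_subset_left)
      ⟨subset_closure (mem_connectedComponentIn (h2K M hM)), h2K M hM⟩ inter_subset_right
  have hclosed : IsClosed (U K) := by
    refine isClosed_of_closure_subset fun z hz ↦ ?_
    by_cases hzK : z ∈ K
    · rw [← hUL] at hz ⊢
      exact hclosure L hL ⟨hz, disjoint_left.1 (hdisj K hK L hL hKL) hzK⟩
    · exact hclosure K hK ⟨hz, hzK⟩
  have huniv : U K = univ := IsClopen.eq_univ ⟨hclosed, hopen K hK⟩
    ⟨2, mem_connectedComponentIn (h2K K hK)⟩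
  obtain ⟨y, hy⟩ := (hcirc K hK).nonempty
  exact hUK K (huniv ▸ mem_univ y) hy

theorem Topology.IsEmbedding.isCircle_image_iff {X Y : Type*} [TopologicalSpace X]
    [TopologicalSpace Y] {e : X → Y} (he : IsEmbedding e) {C : Set X} :
    IsCircle (e '' C) ↔ IsCircle C :=
  ⟨fun ⟨h⟩ ↦ ⟨(he.homeomorphImage C).trans h⟩, fun ⟨h⟩ ↦ ⟨(he.homeomorphImage C).symm.trans h⟩⟩

/-- An embedded open disk is open in a surface with boundary. -/
theorem isOpen_image_ball {S : Type*} [TopologicalSpace S]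
    [ChartedSpace (EuclideanHalfSpace 2) S] {e : Metric.closedBall (0 : ℂ) 1 → S}
    (he : IsEmbedding e) : IsOpen (e '' {x | (x : ℂ) ∈ Metric.ball (0 : ℂ) 1}) := by
  rw [isOpen_iff_mem_nhds]
  rintro _ ⟨x, hx, rfl⟩
  let φ := chartAt (EuclideanHalfSpace 2) (e x)
  let κ : EuclideanHalfSpace 2 → ℂ := fun y ↦ Complex.orthonormalBasisOneI.repr.symm y.1
  have hκ : Continuous κ :=
    Complex.orthonormalBasisOneI.repr.symm.continuous.comp continuous_subtype_val
  have hκinj : Function.Injective κ :=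
    Complex.orthonormalBasisOneI.repr.symm.injective.comp Subtype.val_injective
  have hnhds : e ⁻¹' φ.source ∈ 𝓝 x := he.continuous.continuousAt.preimage_mem_nhds
    (φ.open_source.mem_nhds (mem_chart_source _ _))
  obtain ⟨V, hV, hVsub⟩ := mem_nhds_subtype _ _ _ |>.1 hnhds
  obtain ⟨r, hr, hrsub⟩ := Metric.nhds_basis_closedBall.mem_iff.1
    (Filter.inter_mem hV (Metric.isOpen_ball.mem_nhds hx))
  have hD : ∀ z ∈ Metric.closedBall (x : ℂ) r, z ∈ Metric.closedBall (0 : ℂ) 1 := fun z hz ↦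
    Metric.ball_subset_closedBall (hrsub hz).2
  classical
  let ρ : ℂ → Metric.closedBall (0 : ℂ) 1 := fun z ↦ if h : z ∈ Metric.closedBall (0 : ℂ) 1 then
    ⟨z, h⟩ else x
  have hρ : ∀ z ∈ Metric.closedBall (x : ℂ) r, (ρ z : ℂ) = z := fun z hz ↦ by
    simp only [ρ, dif_pos (hD z hz)]
  have hρc : ContinuousOn ρ (Metric.closedBall (x : ℂ) r) :=
    IsEmbedding.subtypeVal.continuousOn_iff.2 (continuousOn_id.congr hρ)
  have hsource : ∀ z ∈ Metric.closedBall (x : ℂ) r, e (ρ z) ∈ φ.source := fun z hz ↦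
    hVsub (show (ρ z : ℂ) ∈ V from (hρ z hz).symm ▸ (hrsub hz).1)
  have hρx : ρ x = x := Subtype.ext (hρ x (Metric.mem_closedBall_self hr.le))
  have hmain := image_closedBall_mem_nhds (g := fun z ↦ κ (φ (e (ρ z)))) hr
    (hκ.comp_continuousOn (φ.continuousOn.comp (he.continuous.comp_continuousOn hρc) hsource))
    (fun z hz w hw h ↦ by
      have h1 := he.injective (φ.injOn (hsource z hz) (hsource w hw) (hκinj h))
      rw [← hρ z hz, ← hρ w hw, h1])
  simp only [hρx] at hmain
  have hpre : (fun y ↦ κ (φ y)) ⁻¹' ((fun z ↦ κ (φ (e (ρ z)))) '' Metric.closedBall (x : ℂ) r)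
      ∈ 𝓝 (e x) :=
    (hκ.continuousAt.comp (φ.continuousAt (mem_chart_source _ _))).preimage_mem_nhds hmain
  filter_upwards [hpre, φ.open_source.mem_nhds (mem_chart_source _ (e x))]
  rintro y ⟨z, hz, hzy⟩ hy
  refine ⟨ρ z, ?_, φ.injOn (hsource z hz) hy (hκinj hzy)⟩
  change (ρ z : ℂ) ∈ Metric.ball 0 1
  rw [hρ z hz]
  exact (hrsub hz).2

/-- A set in a circle decomposition of a surface with boundary is not the boundary of an
embedded closed unit disk of `ℂ`. -/
theorem IsCircleDecomposition.image_sphere_notMem {S : Type*} [TopologicalSpace S] [T2Space S]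
    [ChartedSpace (EuclideanHalfSpace 2) S] {𝒞 : Set (Set S)} (h𝒞 : IsCircleDecomposition 𝒞)
    {e : Metric.closedBall (0 : ℂ) 1 → S} (he : IsEmbedding e) :
    e '' {x | (x : ℂ) ∈ Metric.sphere (0 : ℂ) 1} ∉ 𝒞 := by
  intro hC
  obtain ⟨hcirc, hdisj, hcover⟩ := h𝒞
  have hrange : ∀ C ∈ 𝒞, ∀ x, e x ∈ C → C ⊆ range e := by
    intro C hC' x hx
    by_cases hCe : C = e '' {x | (x : ℂ) ∈ Metric.sphere (0 : ℂ) 1}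
    · exact hCe ▸ image_subset_range _ _
    have hdis := disjoint_left.1 (hdisj C hC' _ hC hCe)
    have hball : ∀ y, e y ∈ C → (y : ℂ) ∈ Metric.ball (0 : ℂ) 1 := fun y hy ↦ by
      have h1 : (y : ℂ) ∉ Metric.sphere (0 : ℂ) 1 := fun h ↦ hdis hy ⟨y, h, rfl⟩
      exact lt_of_le_of_ne y.2 h1
    have hclosed : IsClosed (range e) := (isCompact_range he.continuous).isClosed
    refine ((hcirc C hC').isPreconnected.subset_left_of_subset_union (isOpen_image_ball he)
      hclosed.isOpen_compl (disjoint_compl_right.mono_left (image_subset_range _ _))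
      (fun y hy ↦ ?_) ⟨e x, hx, x, hball x hx, rfl⟩).trans (image_subset_range _ _)
    by_cases hye : y ∈ range e
    · obtain ⟨y, rfl⟩ := hye
      exact .inl ⟨y, hball y hy, rfl⟩
    · exact .inr hye
  refine closedBall_ne_sUnion_of_isCircle
    (𝒦 := {K | ∃ C ∈ 𝒞, C ⊆ range e ∧ K = (↑) '' (e ⁻¹' C)}) ?_ ?_ ?_
  · rintro _ ⟨C, hC', hCe, rfl⟩
    rw [IsEmbedding.subtypeVal.isCircle_image_iff, ← he.isCircle_image_iff,
      image_preimage_eq_of_subset hCe]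
    exact hcirc C hC'
  · rintro _ ⟨C, hC', -, rfl⟩ _ ⟨D, hD, -, rfl⟩ hne
    have hCD : C ≠ D := fun h ↦ hne (by rw [h])
    exact (disjoint_image_iff Subtype.val_injective).2 ((hdisj C hC' D hD hCD).preimage e)
  · ext z
    constructor
    · rintro ⟨_, ⟨C, -, -, rfl⟩, y, -, rfl⟩
      exact y.2
    · intro hz
      obtain ⟨C, hC', hzC⟩ := mem_sUnion.1 (hcover ▸ mem_univ (e ⟨z, hz⟩))
      exact ⟨_, ⟨C, hC', hrange C hC' _ hzC, rfl⟩, ⟨z, hz⟩, hzC, rfl⟩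

/-- If `𝒞` is a circle decomposition of a surface `S` (a nonempty connected Hausdorff
second-countable topological 2-manifold, possibly with boundary), then no element of `𝒞`
bounds a disk in `S`. -/
theorem circle_decomposition_no_element_bounds_disk
    {S : Type*} [TopologicalSpace S] [T2Space S] [SecondCountableTopology S]
    [ConnectedSpace S] [Nonempty S] [ChartedSpace (EuclideanHalfSpace 2) S]
    (𝒞 : Set (Set S)) (h𝒞 : IsCircleDecomposition 𝒞) :
    ∀ C ∈ 𝒞, ¬ BoundsADisk C := by
  rintro _ hC ⟨f, hf, rfl⟩
  let ψ := Complex.orthonormalBasisOneI.repr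
  let E : Metric.closedBall (0 : ℂ) 1 ≃ₜ Metric.closedBall (0 : EuclideanSpace ℝ (Fin 2)) 1 :=
    ψ.toHomeomorph.subtype fun z ↦ by simp
  refine h𝒞.image_sphere_notMem (hf.comp E.isEmbedding) ?_
  convert! hC using 1
  rw [image_comp]
  congr 1
  rw [← E.coe_toEquiv, E.toEquiv.image_eq_preimage_symm]
  ext y
  have hy : ‖(y : EuclideanSpace ℝ (Fin 2))‖ = ‖((E.symm y : Metric.closedBall (0 : ℂ) 1) : ℂ)‖ :=
    (ψ.symm.norm_map y).symm
  simp [hy]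
end

section
/- Let D be a circle contained in the annulus A with D ≠ C₀. Then there exists at least one connected component U of A \ D such that U ∩ C₁ = ∅. -/
open Topology Set

/-- Two continuous logarithms of the same function on a preconnected set that agree at one point
agree on the whole set. -/
theorem eqOn_of_exp_eq {X : Type*} [TopologicalSpace X] {s : Set X} (hs : IsPreconnected s)
    {f g : X → ℂ} (hf : ContinuousOn f s) (hg : ContinuousOn g s)
    (he : ∀ x ∈ s, Complex.exp (f x) = Complex.exp (g x)) {a : X} (ha : a ∈ s) (hfg : f a = g a) :
    EqOn f g s :=
  Complex.isCoveringMap_exp.eqOn_of_comp_eqOn hs hf hg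
    (fun x hx ↦ Subtype.ext (he x hx)) ha hfg

/-- The complement of a path carries a continuous logarithm of `(z - γ 0) / (z - γ 1)`. -/
theorem exists_continuousOn_log_path (γ : C(unitInterval, ℂ)) :
    ∃ L : ℂ → ℂ, ContinuousOn L (range γ)ᶜ ∧
      ∀ z ∉ range γ, Complex.exp (L z) = (z - γ 0) / (z - γ 1) := by
  classical
  have hne (t : unitInterval) (z : ((range γ)ᶜ : Set ℂ)) : (z : ℂ) - γ t ≠ 0 :=
    fun h ↦ z.2 ⟨t, (sub_eq_zero.1 h).symm⟩
  let H : C(unitInterval × ((range γ)ᶜ : Set ℂ), {z : ℂ // z ≠ 0}) :=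
    ⟨fun p ↦ ⟨((p.2 : ℂ) - γ 0) / ((p.2 : ℂ) - γ p.1), div_ne_zero (hne _ _) (hne _ _)⟩, by
      refine Continuous.subtype_mk (Continuous.div (by fun_prop) (by fun_prop) ?_) _
      exact fun p ↦ hne _ _⟩
  have H_zero (z : ((range γ)ᶜ : Set ℂ)) :
      H (0, z) = ⟨Complex.exp ((ContinuousMap.const _ 0 : C(((range γ)ᶜ : Set ℂ), ℂ)) z),
        Complex.exp_ne_zero _⟩ := by
    ext
    simp [H, div_self (hne 0 z)]
  let K := Complex.isCoveringMap_exp.liftHomotopy H (ContinuousMap.const _ 0) H_zero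
  have hK := Complex.isCoveringMap_exp.liftHomotopy_lifts H (ContinuousMap.const _ 0) H_zero
  refine ⟨fun z ↦ if h : z ∈ (range γ)ᶜ then K (1, ⟨z, h⟩) else 0, ?_, fun z hz ↦ ?_⟩
  · rw [continuousOn_iff_continuous_domRestrict]
    have : Continuous fun z : ((range γ)ᶜ : Set ℂ) ↦ K (1, z) := by fun_prop
    convert this using 2 with z
    simp only [domRestrict_apply, dif_pos z.2]
  · have h : z ∈ (range γ)ᶜ := hz
    simp only [dif_pos h]
    exact congrArg Subtype.val (congrFun hK (1, ⟨z, h⟩))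

/-- The function `(z - a) / (z - b)` has no continuous logarithm off `{a, b}`. -/
theorem not_exists_continuousOn_log_div {a b : ℂ} (hab : a ≠ b) :
    ¬ ∃ L : ℂ → ℂ, ContinuousOn L {a, b}ᶜ ∧
      ∀ z ∈ ({a, b}ᶜ : Set ℂ), Complex.exp (L z) = (z - a) / (z - b) := by
  rintro ⟨L, hL, hexp⟩
  have hab' : a - b ≠ 0 := sub_ne_zero.2 hab
  let w : ℝ → ℂ := fun θ ↦ Complex.exp (θ * Complex.I) / 2
  have hw0 (θ : ℝ) : w θ ≠ 0 := div_ne_zero (Complex.exp_ne_zero _) two_ne_zero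
  have hwn (θ : ℝ) : ‖w θ‖ < 1 := by
    simp only [w, norm_div, Complex.norm_exp_ofReal_mul_I]
    norm_num
  have hw1 (θ : ℝ) : 1 + w θ ∈ Complex.slitPlane := Complex.mem_slitPlane_of_norm_lt_one (hwn θ)
  have hwc : Continuous w := by fun_prop
  have hmem (θ : ℝ) : a + (a - b) * w θ ∈ ({a, b}ᶜ : Set ℂ) := by
    rintro (h | h)
    · exact mul_ne_zero hab' (hw0 θ) (by simpa using h)
    · have : (a - b) * (1 + w θ) = 0 := by
        rw [mem_singleton_iff] at h
        linear_combination h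
      exact mul_ne_zero hab' (Complex.slitPlane_ne_zero (hw1 θ)) this
  let G : ℝ → ℂ := fun θ ↦ L (a + (a - b) * w θ) + Complex.log (1 + w θ)
  have hGc : Continuous G := by
    refine Continuous.add (hL.comp_continuous (by fun_prop) hmem) ?_
    exact Continuous.clog (by fun_prop) hw1
  have hGe (θ : ℝ) : Complex.exp (G θ) = w θ := by
    have h1 := Complex.slitPlane_ne_zero (hw1 θ)
    rw [Complex.exp_add, Complex.exp_log h1, hexp _ (hmem θ),
      show a + (a - b) * w θ - b = (a - b) * (1 + w θ) by ring]
    field_simp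
    ring
  have hw00 : w 0 = 1 / 2 := by simp [w]
  have key := eqOn_of_exp_eq (isPreconnected_univ (α := ℝ)) hGc.continuousOn
    (g := fun θ : ℝ ↦ G 0 + θ * Complex.I) (by fun_prop)
    (fun θ _ ↦ by rw [hGe, Complex.exp_add, hGe, hw00]; simp only [w]; ring)
    (mem_univ 0) (by simp)
  have h2 := key (mem_univ (2 * Real.pi))
  have hw2 : w (2 * Real.pi) = w 0 := by simp [w, Complex.exp_two_pi_mul_I]
  have hG2 : G (2 * Real.pi) = G 0 := by simp only [G, hw2]
  simp [hG2, Real.pi_ne_zero] at h2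

/-- Continuous logarithms of the same function on two open sets glue to one on the union when the
intersection of the sets is nonempty and preconnected. -/
theorem exists_continuousOn_log_union {X : Type*} [TopologicalSpace X] {s t : Set X}
    (hs : IsOpen s) (ht : IsOpen t) (hst : IsPreconnected (s ∩ t)) (hne : (s ∩ t).Nonempty)
    {f F G : X → ℂ} (hF : ContinuousOn F s) (hG : ContinuousOn G t)
    (hFe : ∀ x ∈ s, Complex.exp (F x) = f x) (hGe : ∀ x ∈ t, Complex.exp (G x) = f x) :
    ∃ L : X → ℂ, ContinuousOn L (s ∪ t) ∧ ∀ x ∈ s ∪ t, Complex.exp (L x) = f x := by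
  classical
  obtain ⟨x₀, hx₀⟩ := hne
  set c := F x₀ - G x₀ with hc
  have hcexp : Complex.exp c = 1 := by
    rw [hc, Complex.exp_sub, hFe _ hx₀.1, hGe _ hx₀.2, div_self]
    rw [← hFe _ hx₀.1]
    exact Complex.exp_ne_zero _
  have heq : EqOn F (fun x ↦ G x + c) (s ∩ t) :=
    eqOn_of_exp_eq hst (hF.mono inter_subset_left)
      ((hG.mono inter_subset_right).add continuousOn_const)
      (fun x hx ↦ by rw [Complex.exp_add, hcexp, mul_one, hFe _ hx.1, hGe _ hx.2]) hx₀
      (by simp [hc])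
  let L : X → ℂ := fun x ↦ if x ∈ s then F x else G x + c
  have hLs : EqOn L F s := fun x hx ↦ if_pos hx
  have hLt : EqOn L (fun x ↦ G x + c) t := fun x hx ↦ by
    by_cases h : x ∈ s
    · exact (hLs h).trans (heq ⟨h, hx⟩)
    · exact if_neg h
  refine ⟨L, ?_, ?_⟩
  · exact (hF.congr hLs).union_of_isOpen ((hG.add continuousOn_const).congr hLt) hs ht
  · rintro x (hx | hx)
    · rw [hLs hx, hFe x hx]
    · rw [hLt hx, Complex.exp_add, hcexp, mul_one, hGe x hx]

/-- The separation part of the Jordan curve theorem: the complement of a simple closed curve in the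
plane is not connected. -/
theorem not_isPreconnected_compl_range_circle {φ : Circle → ℂ} (hφ : Continuous φ)
    (hinj : Function.Injective φ) : ¬ IsPreconnected (range φ)ᶜ := by
  intro hconn
  have hcomp : IsCompact (range φ) := isCompact_range hφ
  have hne : (range φ)ᶜ.Nonempty := by
    rw [nonempty_compl]
    exact hcomp.ne_univ
  let γ : C(unitInterval, ℂ) :=
    ⟨fun t ↦ φ (Circle.exp (Real.pi * t)), by fun_prop⟩
  let δ : C(unitInterval, ℂ) :=
    ⟨fun t ↦ φ (Circle.exp (-(Real.pi * t))), by fun_prop⟩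
  have hδ1 : δ 1 = γ 1 := by
    refine congrArg φ (Circle.exp_eq_exp.2 ⟨-1, ?_⟩)
    push_cast
    ring
  have hδ0 : δ 0 = γ 0 := by simp [δ, γ]
  have hab : γ 0 ≠ γ 1 := by
    intro h
    have := hinj h
    simp only [Set.Icc.coe_zero, mul_zero, Circle.exp_zero, Set.Icc.coe_one,
      mul_one] at this
    exact Circle.exp_pi_ne_one this.symm
  have hunion : range γ ∪ range δ = range φ := by
    apply subset_antisymm
    · rintro _ (⟨t, rfl⟩ | ⟨t, rfl⟩) <;> exact mem_range_self _
    · rintro _ ⟨z, rfl⟩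
      have hpi := Real.pi_pos
      have h1 := Complex.neg_pi_lt_arg (z : ℂ)
      have h2 := Complex.arg_le_pi (z : ℂ)
      rcases le_total 0 (Complex.arg z) with h | h
      · refine Or.inl ⟨⟨Complex.arg z / Real.pi, by positivity, (div_le_one hpi).2 h2⟩, ?_⟩
        change φ (Circle.exp (Real.pi * (Complex.arg z / Real.pi))) = φ z
        rw [mul_div_cancel₀ _ hpi.ne', Circle.exp_arg]
      · refine Or.inr ⟨⟨-Complex.arg z / Real.pi, div_nonneg (by linarith) hpi.le,
          (div_le_one hpi).2 (by linarith)⟩, ?_⟩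
        change φ (Circle.exp (-(Real.pi * (-Complex.arg z / Real.pi)))) = φ z
        rw [mul_div_cancel₀ _ hpi.ne', neg_neg, Circle.exp_arg]
  have hinter : range γ ∩ range δ ⊆ {γ 0, γ 1} := by
    rintro _ ⟨⟨t, rfl⟩, ⟨s, hs⟩⟩
    obtain ⟨m, hm⟩ := Circle.exp_eq_exp.1 (hinj hs)
    have hpi := Real.pi_pos
    have hts : (t : ℝ) + s = -2 * m := by
      have : Real.pi * ((t : ℝ) + s) = Real.pi * (-2 * m) := by linear_combination -hm
      exact mul_left_cancel₀ hpi.ne' this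
    have ht := t.2
    have hs' := s.2
    have hm0 : m ≤ 0 := by
      have : (m : ℝ) ≤ 0 := by linarith [ht.1, hs'.1]
      exact_mod_cast this
    have hm1 : -1 ≤ m := by
      have : (-1 : ℝ) ≤ m := by linarith [ht.2, hs'.2]
      exact_mod_cast this
    obtain rfl | rfl : m = 0 ∨ m = -1 := by lia
    · left
      congr 1
      ext
      push_cast at hts
      simp only [Set.Icc.coe_zero]
      linarith [ht.1, hs'.1]
    · right
      rw [mem_singleton_iff]
      congr 1
      ext
      push_cast at hts
      simp only [Set.Icc.coe_one]
      linarith [ht.2, hs'.2]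
  obtain ⟨F, hF, hFe⟩ := exists_continuousOn_log_path γ
  obtain ⟨G, hG, hGe⟩ := exists_continuousOn_log_path δ
  rw [hδ0, hδ1] at hGe
  have hst : (range γ)ᶜ ∩ (range δ)ᶜ = (range φ)ᶜ := by rw [← compl_union, hunion]
  obtain ⟨L, hL, hLe⟩ := exists_continuousOn_log_union
    (isCompact_range γ.continuous).isClosed.isOpen_compl
    (isCompact_range δ.continuous).isClosed.isOpen_compl (hst ▸ hconn) (hst ▸ hne)
    hF hG hFe hGe
  have hsub : ({γ 0, γ 1}ᶜ : Set ℂ) ⊆ (range γ)ᶜ ∪ (range δ)ᶜ := by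
    rw [← compl_inter]
    exact compl_subset_compl.2 hinter
  exact not_exists_continuousOn_log_div hab ⟨L, hL.mono hsub, fun z hz ↦ hLe z (hsub hz)⟩

/-- A continuous real-valued function on the circle is not injective. -/
theorem Circle.not_injective_of_continuous_real {g : Circle → ℝ} (hg : Continuous g) :
    ¬ Function.Injective g := by
  intro hinj
  let h : ℝ → ℝ := fun t ↦ g (Circle.exp t) - g (Circle.exp (t + Real.pi))
  have hc : Continuous h := by fun_prop
  have hpi : h Real.pi = -h 0 := by
    simp only [h, zero_add, neg_sub]
    rw [← two_mul, Circle.exp_two_pi, Circle.exp_zero]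
  have h0 : (0 : ℝ) ∈ range h := by
    rcases le_total (h 0) 0 with h' | h'
    · exact mem_range_of_exists_le_of_exists_ge hc ⟨0, h'⟩ ⟨Real.pi, by linarith⟩
    · exact mem_range_of_exists_le_of_exists_ge hc ⟨Real.pi, by linarith⟩ ⟨0, h'⟩
  obtain ⟨t, ht⟩ := h0
  have heq := hinj (sub_eq_zero.1 ht)
  rw [Circle.exp_add, left_eq_mul] at heq
  exact Circle.exp_pi_ne_one heq

/-- A continuous injective self-map of the circle is surjective. -/
theorem Circle.surjective_of_continuous_of_injective {ψ : Circle → Circle} (hψ : Continuous ψ)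
    (hinj : Function.Injective ψ) : Function.Surjective ψ := by
  intro p
  by_contra! hp
  let c : Circle := Circle.exp Real.pi * p⁻¹
  have hslit (z : Circle) : ((c * ψ z : Circle) : ℂ) ∈ Complex.slitPlane := by
    rw [Complex.mem_slitPlane_iff_arg]
    refine ⟨fun harg ↦ hp z ?_, Circle.coe_ne_zero _⟩
    have h1 := Circle.exp_arg (c * ψ z)
    rw [harg] at h1
    have h2 : p⁻¹ * ψ z = 1 := by
      rwa [mul_assoc, left_eq_mul] at h1
    exact (inv_mul_eq_one.1 h2).symm
  refine Circle.not_injective_of_continuous_real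
    (g := fun z ↦ Complex.arg ((c * ψ z : Circle) : ℂ)) ?_ ?_
  · rw [continuous_iff_continuousAt]
    intro z
    exact (Complex.continuousAt_arg (hslit z)).comp
      (f := fun z ↦ ((c * ψ z : Circle) : ℂ)) (by fun_prop)
  · intro z w h
    exact hinj (mul_left_cancel (Circle.arg_eq_arg.1 h))

/-- No circle is a proper subset of another circle. -/
theorem IsCircle.eq_of_subset {X : Type*} [TopologicalSpace X] {C D : Set X}
    (hC : IsCircle C) (hD : IsCircle D) (h : C ⊆ D) : C = D := by
  obtain ⟨e⟩ := hC
  obtain ⟨f⟩ := hD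
  refine subset_antisymm h fun x hx ↦ ?_
  obtain ⟨z, hz⟩ := Circle.surjective_of_continuous_of_injective
    (ψ := fun z ↦ f (inclusion h (e.symm z)))
    (f.continuous.comp ((continuous_inclusion h).comp e.symm.continuous))
    (f.injective.comp ((inclusion_injective h).comp e.symm.injective)) (f ⟨x, hx⟩)
  have := congrArg Subtype.val (f.injective hz)
  rw [← show ((e.symm z : C) : X) = x from this]
  exact (e.symm z).2

/-- The standard embedding of the annulus in the plane, onto `1 ≤ ‖z‖ ≤ 2`. -/
noncomputable def annulusToPlane (p : Circle × Set.Icc (0 : ℝ) 1) : ℂ :=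
  ((1 + p.2 : ℝ) : ℂ) * p.1

theorem continuous_annulusToPlane : Continuous annulusToPlane := by
  unfold annulusToPlane
  fun_prop

theorem norm_annulusToPlane (p : Circle × Set.Icc (0 : ℝ) 1) :
    ‖annulusToPlane p‖ = 1 + (p.2 : ℝ) := by
  rw [annulusToPlane, norm_mul, Circle.norm_coe, mul_one, Complex.norm_real, Real.norm_eq_abs,
    abs_of_nonneg (by linarith [p.2.2.1])]

theorem annulusToPlane_injective : Function.Injective annulusToPlane := by
  intro p q h
  have h2 : (p.2 : ℝ) = q.2 := by
    have := congrArg norm h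
    rw [norm_annulusToPlane, norm_annulusToPlane] at this
    linarith
  refine Prod.ext (Circle.ext ?_) (Subtype.ext h2)
  rw [annulusToPlane, annulusToPlane, h2] at h
  refine mul_left_cancel₀ (Complex.ofReal_ne_zero.2 ?_) h
  linarith [q.2.2.1]

theorem exists_annulusToPlane_eq {z : ℂ} (h1 : 1 ≤ ‖z‖) (h2 : ‖z‖ ≤ 2) :
    ∃ p, annulusToPlane p = z := by
  refine ⟨(Circle.exp (Complex.arg z), ⟨‖z‖ - 1, by linarith, by linarith⟩), ?_⟩
  simp [annulusToPlane, Circle.coe_exp, Complex.norm_mul_exp_arg_mul_I]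

/-- The exterior of a closed disc centred at the origin is connected. -/
theorem Complex.isPreconnected_setOf_lt_norm (r : ℝ) :
    IsPreconnected {z : ℂ | r < ‖z‖} := by
  have himg : {z : ℂ | r < ‖z‖} =
      (fun p : ℝ × ℝ ↦ (p.1 : ℂ) * Complex.exp (p.2 * Complex.I)) '' (Ioi r ×ˢ univ) := by
    ext z
    constructor
    · exact fun hz ↦ ⟨(‖z‖, Complex.arg z), ⟨hz, mem_univ _⟩, Complex.norm_mul_exp_arg_mul_I z⟩
    · rintro ⟨⟨s, θ⟩, ⟨hs, -⟩, rfl⟩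
      rw [mem_Ioi] at hs
      simpa [Complex.norm_exp_ofReal_mul_I] using hs.trans_le (le_abs_self s)
  rw [himg]
  exact (isPreconnected_Ioi.prod isPreconnected_univ).image _ (by fun_prop)

/-- If `D` misses a point of the inner boundary circle and every component of the complement of `D`
in the annulus reaches the outer boundary circle, then the complement of `D` in the plane is
connected. -/
theorem isPreconnected_compl_image_annulusToPlane {D : Set (Circle × Set.Icc (0 : ℝ) 1)}
    (hinner : ∃ u, (u, 0) ∉ D)
    (houter : ∀ x ∈ Dᶜ, ∃ y ∈ connectedComponentIn Dᶜ x, (y.2 : ℝ) = 1) :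
    IsPreconnected (annulusToPlane '' D)ᶜ := by
  have himage {t : Set (Circle × Set.Icc (0 : ℝ) 1)} (ht : t ⊆ Dᶜ) :
      annulusToPlane '' t ⊆ (annulusToPlane '' D)ᶜ := by
    rintro _ ⟨x, hx, rfl⟩ h
    exact ht hx (annulusToPlane_injective.mem_set_image.1 h)
  have hE : {z : ℂ | 2 < ‖z‖} ⊆ (annulusToPlane '' D)ᶜ := by
    rintro _ hz ⟨p, -, rfl⟩
    rw [mem_ofPred_eq, norm_annulusToPlane] at hz
    linarith [p.2.2.2]
  have hannulus (x) (hx : x ∈ Dᶜ) : ∃ t, t ⊆ (annulusToPlane '' D)ᶜ ∧ (3 : ℂ) ∈ t ∧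
      annulusToPlane x ∈ t ∧ IsPreconnected t := by
    obtain ⟨y, hy, hy1⟩ := houter x hx
    let R : Set ℂ := (fun r : ℝ ↦ (r : ℂ) * y.1) '' Ici 2
    have hR : IsPreconnected R := isPreconnected_Ici.image _ (by fun_prop)
    have hyR : annulusToPlane y ∈ R := ⟨2, self_mem_Ici, by simp [annulusToPlane, hy1]; norm_num⟩
    have hRsub : R ⊆ (annulusToPlane '' D)ᶜ := by
      rintro _ ⟨r, hr, rfl⟩
      rcases (mem_Ici.1 hr).eq_or_lt with rfl | hr
      · have : ((2 : ℝ) : ℂ) * y.1 = annulusToPlane y := by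
          simp [annulusToPlane, hy1]; norm_num
        dsimp only
        rw [this]
        exact himage (connectedComponentIn_subset _ _) (mem_image_of_mem _ hy)
      · refine hE ?_
        simpa [Circle.norm_coe y.1] using hr.trans_le (le_abs_self r)
    have h3 : (3 : ℝ) * (y.1 : ℂ) ∈ {z : ℂ | 2 < ‖z‖} := by
      simp [Circle.norm_coe y.1]; norm_num
    have hRE : IsPreconnected (R ∪ {z : ℂ | 2 < ‖z‖}) :=
      hR.union _ ⟨3, by simp; norm_num, rfl⟩ h3
        (Complex.isPreconnected_setOf_lt_norm 2)
    refine ⟨annulusToPlane '' connectedComponentIn Dᶜ x ∪ (R ∪ {z : ℂ | 2 < ‖z‖}),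
      union_subset (himage (connectedComponentIn_subset _ _)) (union_subset hRsub hE),
      Or.inr (Or.inr (by simp; norm_num)), Or.inl (mem_image_of_mem _ (mem_connectedComponentIn hx)),
      IsPreconnected.union _ (mem_image_of_mem _ hy) (Or.inl hyR) ?_ hRE⟩
    exact isPreconnected_connectedComponentIn.image _ continuous_annulusToPlane.continuousOn
  refine isPreconnected_of_forall 3 fun z hz ↦ ?_
  rcases lt_or_ge ‖z‖ 1 with h1 | h1
  · obtain ⟨u, hu⟩ := hinner
    obtain ⟨t, htsub, h3t, hut, ht⟩ := hannulus (u, 0) hu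
    have hu1 : ‖annulusToPlane (u, 0)‖ = 1 := by simp [norm_annulusToPlane]
    have hB : IsPreconnected (insert (annulusToPlane (u, 0)) (Metric.ball (0 : ℂ) 1)) := by
      refine Metric.isPreconnected_ball.subset_closure (subset_insert _ _) ?_
      rw [closure_ball _ one_ne_zero]
      exact insert_subset (by simp [hu1]) Metric.ball_subset_closedBall
    refine ⟨t ∪ insert (annulusToPlane (u, 0)) (Metric.ball (0 : ℂ) 1),
      union_subset htsub (insert_subset (htsub hut) ?_), Or.inl h3t,
      Or.inr (Or.inr (by simpa using h1)), ht.union _ hut (mem_insert _ _) hB⟩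
    rintro _ hw ⟨p, -, rfl⟩
    rw [mem_ball_zero_iff, norm_annulusToPlane] at hw
    linarith [p.2.2.1]
  · rcases le_or_gt ‖z‖ 2 with h2 | h2
    · obtain ⟨p, rfl⟩ := exists_annulusToPlane_eq h1 h2
      exact hannulus p fun hp ↦ hz (mem_image_of_mem _ hp)
    · exact ⟨_, hE, by simp; norm_num, h2, Complex.isPreconnected_setOf_lt_norm 2⟩

/-- The inner boundary circle of the annulus is a circle. -/
theorem isCircle_setOf_snd_eq_zero :
    IsCircle {p : Circle × Set.Icc (0 : ℝ) 1 | (p.2 : ℝ) = 0} :=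
  ⟨{ toFun := fun p ↦ p.1.1
     invFun := fun u ↦ ⟨(u, 0), rfl⟩
     left_inv := fun p ↦ Subtype.ext (Prod.ext rfl (Subtype.ext p.2.symm))
     right_inv := fun _ ↦ rfl
     continuous_toFun := by fun_prop
     continuous_invFun := by fun_prop }⟩

/-- In the annulus `A = Circle × [0,1]`, if `D` is a circle with `D ≠ C₀` (where
`C₀` is the boundary circle at height `0` and `C₁` the one at height `1`), then some
connected component `U` of `A \ D` satisfies `U ∩ C₁ = ∅`. -/
theorem exists_component_disjoint_from_C1
    (D : Set (Circle × Set.Icc (0:ℝ) 1)) (hD : IsCircle D)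
    (hne : D ≠ {p : Circle × Set.Icc (0:ℝ) 1 | (p.2 : ℝ) = 0}) :
    ∃ U : Set (Circle × Set.Icc (0:ℝ) 1),
      (∃ x ∈ Dᶜ, U = connectedComponentIn Dᶜ x) ∧
      U ∩ {p : Circle × Set.Icc (0:ℝ) 1 | (p.2 : ℝ) = 1} = ∅ := by
  by_contra! H
  have houter : ∀ x ∈ Dᶜ, ∃ y ∈ connectedComponentIn Dᶜ x, (y.2 : ℝ) = 1 := fun x hx ↦
    H _ ⟨x, hx, rfl⟩
  have hinner : ∃ u, (u, 0) ∉ D := by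
    by_contra! hsub
    refine hne (isCircle_setOf_snd_eq_zero.eq_of_subset hD ?_).symm
    rintro ⟨u, t⟩ ht
    obtain rfl : t = 0 := Subtype.ext ht
    exact hsub u
  obtain ⟨e⟩ := hD
  have hrange : range (fun z ↦ annulusToPlane (e.symm z : Circle × Set.Icc (0 : ℝ) 1)) =
      annulusToPlane '' D := by
    ext z
    constructor
    · rintro ⟨w, rfl⟩
      exact mem_image_of_mem _ (e.symm w).2
    · rintro ⟨p, hp, rfl⟩
      exact ⟨e ⟨p, hp⟩, by simp⟩
  refine not_isPreconnected_compl_range_circle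
    (continuous_annulusToPlane.comp (continuous_subtype_val.comp e.symm.continuous))
    (annulusToPlane_injective.comp (Subtype.val_injective.comp e.symm.injective)) ?_
  exact hrange ▸ isPreconnected_compl_image_annulusToPlane hinner houter
end
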